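/- Let L > 0, k > 0, τ ∈ ℝ and A ≠ 0 be real numbers with sin(kL) ≠ 0. Define ψ : ℝ → ℝ by ψ(x) = −A·sin(k(x+L)) for x ≤ 0 and ψ(x) = A·sin(k(x−L)) for x ≥ 0 (the two formulas agree at x = 0), and let g : ℝ → ℝ be its almost-everywhere derivative, g(x) = −A·k·cos(k(x+L)) for x < 0 and g(x) = A·k·cos(k(x−L)) for x > 0. Then the following are equivalent: (a) for every infinitely differentiable φ : ℝ → ℝ with compact support contained in the open interval (−L, L), (1/2)·∫ g(x)·φ'(x) dx + τ·ψ(0)·φ(0) = (k²/2)·∫ ψ(x)·φ(x) dx; (b) k·cos(kL) = −τ·sin(kL), i.e. k·cot(kL) = −τ. -/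

import Mathlib

open MeasureTheory Set

/-- Integration by parts against a compactly supported function, for a function which is `C¹` on
each of the closed half-lines, with a jump at the origin. -/
theorem integral_mul_deriv_add_of_jump {u v u' v' f f' φ : ℝ → ℝ}
    (hu : ∀ x, HasDerivAt u (u' x) x) (hv : ∀ x, HasDerivAt v (v' x) x)
    (hu' : Continuous u') (hv' : Continuous v')
    (hφ : ContDiff ℝ 1 φ) (hc : HasCompactSupport φ)
    (hfu : ∀ x < 0, f x = u x) (hfv : ∀ x > 0, f x = v x)
    (hfu' : ∀ x ≤ 0, f' x = u' x) (hfv' : ∀ x > 0, f' x = v' x) :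
    (∫ x, f x * deriv φ x) + ∫ x, f' x * φ x = (u 0 - v 0) * φ 0 := by
  have hφ' : Continuous (deriv φ) := hφ.continuous_deriv le_rfl
  have hdu : deriv u = u' := funext fun x => (hu x).deriv
  have hdv : deriv v = v' := funext fun x => (hv x).deriv
  have hcu : ContDiff ℝ 1 u :=
    contDiff_one_iff_deriv.2 ⟨fun x => (hu x).differentiableAt, hdu ▸ hu'⟩
  have hcv : ContDiff ℝ 1 v :=
    contDiff_one_iff_deriv.2 ⟨fun x => (hv x).differentiableAt, hdv ▸ hv'⟩
  have hφd : ∀ x, HasDerivAt φ (deriv φ x) x := fun x =>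
    (hφ.differentiable one_ne_zero x).hasDerivAt
  have int_mul : ∀ {w : ℝ → ℝ}, Continuous w → Integrable fun x => w x * φ x := fun hw =>
    (hw.mul hφ.continuous).integrable_of_hasCompactSupport hc.mul_left
  have int_mul' : ∀ {w : ℝ → ℝ}, Continuous w → Integrable fun x => w x * deriv φ x := fun hw =>
    (hw.mul hφ').integrable_of_hasCompactSupport hc.deriv.mul_left
  have ae_left : ∀ᵐ x : ℝ, x ∈ Iic (0 : ℝ) → f x * deriv φ x = u x * deriv φ x := by
    filter_upwards [Measure.ae_ne volume (0 : ℝ)] with x hx hx'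
    rw [hfu x (lt_of_le_of_ne hx' hx)]
  have e1 : ∫ x in Iic 0, f x * deriv φ x = ∫ x in Iic 0, u x * deriv φ x :=
    setIntegral_congr_ae measurableSet_Iic ae_left
  have e2 : EqOn (fun x => f x * deriv φ x) (fun x => v x * deriv φ x) (Ioi 0) :=
    fun x hx => by simp only [hfv x hx]
  have e3 : EqOn (fun x => f' x * φ x) (fun x => u' x * φ x) (Iic 0) :=
    fun x hx => by simp only [hfu' x hx]
  have e4 : EqOn (fun x => f' x * φ x) (fun x => v' x * φ x) (Ioi 0) :=
    fun x hx => by simp only [hfv' x hx]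
  have i1 : IntegrableOn (fun x => f x * deriv φ x) (Iic 0) :=
    (int_mul' hcu.continuous).integrableOn.congr_fun_ae <|
      Filter.EventuallyEq.symm ((ae_restrict_iff' measurableSet_Iic).2 ae_left)
  have i2 : IntegrableOn (fun x => f x * deriv φ x) (Ioi 0) :=
    (int_mul' hcv.continuous).integrableOn.congr_fun e2.symm measurableSet_Ioi
  have i3 : IntegrableOn (fun x => f' x * φ x) (Iic 0) :=
    (int_mul hu').integrableOn.congr_fun e3.symm measurableSet_Iic
  have i4 : IntegrableOn (fun x => f' x * φ x) (Ioi 0) :=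
    (int_mul hv').integrableOn.congr_fun e4.symm measurableSet_Ioi
  have left : (∫ x in Iic 0, u' x * φ x) + ∫ x in Iic 0, u x * deriv φ x = u 0 * φ 0 := by
    rw [← integral_add (int_mul hu').integrableOn (int_mul' hcu.continuous).integrableOn]
    have h := HasCompactSupport.integral_Iic_deriv_eq (hcu.mul hφ) hc.mul_left 0
    have hd : deriv (fun x => u x * φ x) = fun x => u' x * φ x + u x * deriv φ x :=
      funext fun x => ((hu x).mul (hφd x)).deriv
    rwa [hd] at h
  have right : (∫ x in Ioi 0, v' x * φ x) + ∫ x in Ioi 0, v x * deriv φ x = -(v 0 * φ 0) := by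
    rw [← integral_add (int_mul hv').integrableOn (int_mul' hcv.continuous).integrableOn]
    have h := HasCompactSupport.integral_Ioi_deriv_eq (hcv.mul hφ) hc.mul_left 0
    have hd : deriv (fun x => v x * φ x) = fun x => v' x * φ x + v x * deriv φ x :=
      funext fun x => ((hv x).mul (hφd x)).deriv
    rwa [hd] at h
  rw [← intervalIntegral.integral_Iic_add_Ioi i1 i2, ← intervalIntegral.integral_Iic_add_Ioi i3 i4,
    e1, setIntegral_congr_fun measurableSet_Ioi e2, setIntegral_congr_fun measurableSet_Iic e3,
    setIntegral_congr_fun measurableSet_Ioi e4]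
  linear_combination left + right

/-- There is a smooth function supported in `(-L, L)` which takes the value `1` at the origin. -/
theorem exists_contDiff_tsupport_subset_Ioo_apply_zero {L : ℝ} (hL : 0 < L) :
    ∃ φ : ℝ → ℝ, ContDiff ℝ (⊤ : ℕ∞) φ ∧ HasCompactSupport φ ∧ tsupport φ ⊆ Ioo (-L) L ∧
      φ 0 = 1 := by
  let b : ContDiffBump (0 : ℝ) := ⟨L / 4, L / 2, by positivity, by linarith⟩
  refine ⟨b, b.contDiff, b.hasCompactSupport, ?_, b.one_of_mem_closedBall (by simpa using b.rIn_pos.le)⟩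
  rw [b.tsupport_eq, Real.closedBall_eq_Icc]
  intro x hx
  have h1 : 0 - L / 2 ≤ x := hx.1
  have h2 : x ≤ 0 + L / 2 := hx.2
  constructor <;> linarith


/-- For the particle in a box `[−L, L]` with a delta potential `τδ₀` at the
origin, the even piecewise-sine state `ψ` is a weak eigenfunction of energy
`k²/2` (tested against smooth functions compactly supported in `(−L, L)`) if
and only if the quantization condition `k·cos(kL) = −τ·sin(kL)`
(i.e. `k·cot(kL) = −τ`) holds. -/
theorem delta_barrier_quantization (L k τ A : ℝ)
    (hL : 0 < L) (hk : 0 < k) (hA : A ≠ 0) (hsin : Real.sin (k * L) ≠ 0)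
    (ψ g : ℝ → ℝ)
    (hψ : ∀ x, ψ x = if x ≤ 0 then -A * Real.sin (k * (x + L))
      else A * Real.sin (k * (x - L)))
    (hg : ∀ x, g x = if x < 0 then -A * k * Real.cos (k * (x + L))
      else A * k * Real.cos (k * (x - L))) :
    (∀ φ : ℝ → ℝ, ContDiff ℝ (⊤ : ℕ∞) φ → HasCompactSupport φ →
        tsupport φ ⊆ Set.Ioo (-L) L →
        (1 / 2) * (∫ x, g x * deriv φ x) + τ * ψ 0 * φ 0 =
          (k ^ 2 / 2) * ∫ x, ψ x * φ x) ↔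
      k * Real.cos (k * L) = -τ * Real.sin (k * L) := by
  have hψ0 : ψ 0 = -A * Real.sin (k * L) := by simp [hψ]
  have key : ∀ φ : ℝ → ℝ, ContDiff ℝ (⊤ : ℕ∞) φ → HasCompactSupport φ →
      (∫ x, g x * deriv φ x) - k ^ 2 * ∫ x, ψ x * φ x =
        -(2 * A * k * Real.cos (k * L)) * φ 0 := by
    intro φ hφ hc
    have hu : ∀ x, HasDerivAt (fun x => -A * k * Real.cos (k * (x + L)))
        (-k ^ 2 * (-A * Real.sin (k * (x + L)))) x := fun x =>
      ((((hasDerivAt_id' x).add_const L).const_mul k).cos.const_mul (-A * k)).congr_deriv (by ring)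
    have hv : ∀ x, HasDerivAt (fun x => A * k * Real.cos (k * (x - L)))
        (-k ^ 2 * (A * Real.sin (k * (x - L)))) x := fun x =>
      ((((hasDerivAt_id' x).sub_const L).const_mul k).cos.const_mul (A * k)).congr_deriv (by ring)
    have h := integral_mul_deriv_add_of_jump (f := g) (f' := fun x => -k ^ 2 * ψ x) hu hv
      (by fun_prop) (by fun_prop) (hφ.of_le (by exact_mod_cast le_top)) hc
      (fun x hx => by rw [hg, if_pos hx]) (fun x hx => by rw [hg, if_neg hx.le.not_gt])
      (fun x hx => by rw [hψ, if_pos hx]) (fun x hx => by rw [hψ, if_neg hx.not_ge])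
    simp only [mul_assoc (-k ^ 2), integral_const_mul, zero_add, zero_sub, mul_neg,
      Real.cos_neg] at h
    linear_combination h
  constructor
  · intro h
    obtain ⟨φ, hφ, hc, hs, h1⟩ := exists_contDiff_tsupport_subset_Ioo_apply_zero hL
    have e := h φ hφ hc hs
    have e' := key φ hφ hc
    rw [h1] at e e'
    rw [hψ0] at e
    apply mul_left_cancel₀ hA
    linear_combination e' / 2 - e
  · intro h φ hφ hc _
    have e' := key φ hφ hc
    rw [hψ0]
    linear_combination e' / 2 - A * φ 0 * h
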